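/- Interactive communication preserves conditional independence: Let A, B, W be finite-valued random variables with I(A; B | W) = 0, and let C₁, …, C_r be finite-valued random variables such that H(C_i | C_{1:i-1}, A, W) = 0 for odd i and H(C_i | C_{1:i-1}, B, W) = 0 for even i. Then I(A; B | W, C₁, …, C_r) = 0. -/

import Mathlib

open scoped BigOperators
open Finset

noncomputable section

namespace Coord

variable {Ω α β γ : Type*}

/-- `p` is a probability mass function on the finite type `α`. -/
def IsPMF [Fintype α] (p : α → ℝ) : Prop := (∀ a, 0 ≤ p a) ∧ ∑ a, p a = 1

/-- ℓ¹ (total variation) distance between two functions on a finite type. -/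
def l1dist [Fintype α] (p q : α → ℝ) : ℝ := ∑ a, |p a - q a|

/-- The distribution (pushforward pmf) of the random variable `X` defined on the
finite sample space `Ω` carrying the pmf `μ`. -/
def distr [Fintype Ω] [DecidableEq α] (μ : Ω → ℝ) (X : Ω → α) : α → ℝ :=
  fun a => ∑ ω, if X ω = a then μ ω else 0

/-- Shannon entropy (base 2) of a pmf. -/
def entFun [Fintype α] (p : α → ℝ) : ℝ := - ∑ a, p a * Real.logb 2 (p a)

/-- Shannon entropy `H(X)` of a random variable `X` on `(Ω, μ)`. -/
def H [Fintype Ω] [Fintype α] [DecidableEq α] (μ : Ω → ℝ) (X : Ω → α) : ℝ :=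
  entFun (distr μ X)

/-- Conditional entropy `H(X | Z)`. -/
def condEnt [Fintype Ω] [Fintype α] [Fintype γ] [DecidableEq α] [DecidableEq γ]
    (μ : Ω → ℝ) (X : Ω → α) (Z : Ω → γ) : ℝ :=
  H μ (fun ω => (X ω, Z ω)) - H μ Z

/-- Mutual information `I(X; Y)`. -/
def mi [Fintype Ω] [Fintype α] [Fintype β] [DecidableEq α] [DecidableEq β]
    (μ : Ω → ℝ) (X : Ω → α) (Y : Ω → β) : ℝ :=
  H μ X + H μ Y - H μ (fun ω => (X ω, Y ω))

/-- Conditional mutual information `I(X; Y | Z)`. -/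
def cmi [Fintype Ω] [Fintype α] [Fintype β] [Fintype γ]
    [DecidableEq α] [DecidableEq β] [DecidableEq γ]
    (μ : Ω → ℝ) (X : Ω → α) (Y : Ω → β) (Z : Ω → γ) : ℝ :=
  H μ (fun ω => (X ω, Z ω)) + H μ (fun ω => (Y ω, Z ω))
    - H μ (fun ω => (X ω, Y ω, Z ω)) - H μ Z

section Entropy

variable {Ω α β γ δ : Type*} [Fintype Ω] [DecidableEq α] [DecidableEq β] [DecidableEq γ]
  [DecidableEq δ] {μ : Ω → ℝ}

theorem distr_nonneg (hμ : ∀ ω, 0 ≤ μ ω) (X : Ω → α) (a : α) : 0 ≤ distr μ X a :=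
  Finset.sum_nonneg fun ω _ => by split_ifs <;> simp [hμ ω]

theorem le_distr_apply (hμ : ∀ ω, 0 ≤ μ ω) (X : Ω → α) (ω : Ω) : μ ω ≤ distr μ X (X ω) := by
  have h := Finset.single_le_sum (f := fun ω' => if X ω' = X ω then μ ω' else 0)
    (fun ω' _ => by split_ifs <;> simp [hμ ω']) (Finset.mem_univ ω)
  simpa [distr] using h

variable [Fintype α]

theorem sum_mul_comp (X : Ω → α) (g : α → ℝ) :
    ∑ ω, μ ω * g (X ω) = ∑ a, distr μ X a * g a := by
  simp only [distr, Finset.sum_mul]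
  rw [Finset.sum_comm]
  refine Finset.sum_congr rfl fun ω _ => ?_
  simp [ite_mul]

theorem sum_distr_pair (X : Ω → α) (Z : Ω → γ) (c : γ) :
    ∑ a, distr μ (fun ω => (X ω, Z ω)) (a, c) = distr μ Z c := by
  simp only [distr]
  rw [Finset.sum_comm]
  refine Finset.sum_congr rfl fun ω _ => ?_
  simp [Prod.ext_iff, ite_and]

theorem H_eq_sum (X : Ω → α) : H μ X = -∑ ω, μ ω * Real.logb 2 (distr μ X (X ω)) := by
  rw [sum_mul_comp X fun a => Real.logb 2 (distr μ X a)]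
  rfl

variable [Fintype β] [Fintype γ] [Fintype δ]

/-- Entropy does not increase when passing to a function of a random variable. -/
theorem H_le_of_factors (hμ : ∀ ω, 0 ≤ μ ω) {X : Ω → α} {Y : Ω → β}
    (h : ∀ ω ω', X ω = X ω' → Y ω = Y ω') : H μ Y ≤ H μ X := by
  rw [H_eq_sum, H_eq_sum]
  refine neg_le_neg (Finset.sum_le_sum fun ω _ => ?_)
  rcases (hμ ω).eq_or_lt with h0 | h0
  · simp [← h0]
  refine mul_le_mul_of_nonneg_left (Real.logb_le_logb_of_le (by norm_num)
    (h0.trans_le (le_distr_apply hμ X ω)) (Finset.sum_le_sum fun ω' _ => ?_)) h0.le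
  by_cases hX : X ω' = X ω
  · simp [hX, h _ _ hX]
  · rw [if_neg hX]
    split_ifs <;> simp [hμ ω']

theorem H_congr (hμ : ∀ ω, 0 ≤ μ ω) {X : Ω → α} {Y : Ω → β}
    (h : ∀ ω ω', X ω = X ω' ↔ Y ω = Y ω') : H μ X = H μ Y :=
  le_antisymm (H_le_of_factors hμ fun ω ω' => (h ω ω').2)
    (H_le_of_factors hμ fun ω ω' => (h ω ω').1)

theorem cmi_nonneg (hμ : ∀ ω, 0 ≤ μ ω) (X : Ω → α) (Y : Ω → β) (Z : Ω → γ) :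
    0 ≤ cmi μ X Y Z := by
  set T : Ω → α × β × γ := fun ω => (X ω, Y ω, Z ω)
  set p := distr μ fun ω => (X ω, Z ω)
  set q := distr μ fun ω => (Y ω, Z ω)
  set t := distr μ T
  set z := distr μ Z
  let ratio : α × β × γ → ℝ := fun a => p (a.1, a.2.2) * q a.2 / (t a * z a.2.2)
  have ratio_sum : ∑ ω, μ ω * ratio (T ω) ≤ ∑ ω, μ ω := by
    calc ∑ ω, μ ω * ratio (T ω) = ∑ a, t a * ratio a := sum_mul_comp T ratio
      _ ≤ ∑ a : α × β × γ, p (a.1, a.2.2) * q a.2 / z a.2.2 := by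
        refine Finset.sum_le_sum fun a _ => ?_
        have hp : 0 ≤ p (a.1, a.2.2) := distr_nonneg hμ _ _
        have hq : 0 ≤ q a.2 := distr_nonneg hμ _ _
        have hz : 0 ≤ z a.2.2 := distr_nonneg hμ _ _
        by_cases ht : t a = 0
        · rw [ht, zero_mul]
          positivity
        · exact le_of_eq (by simp only [ratio]; field_simp)
      _ = ∑ c, z c := by
        simp only [Fintype.sum_prod_type]
        calc ∑ a, ∑ b, ∑ c, p (a, c) * q (b, c) / z c
            = ∑ c, (∑ a, p (a, c)) * (∑ b, q (b, c)) / z c := by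
              simp only [Finset.sum_mul_sum, Finset.sum_div]
              rw [Finset.sum_comm' (t' := Finset.univ) (s' := fun _ => Finset.univ) (by simp)]
              simp only [Finset.sum_comm (s := (Finset.univ : Finset α))]
              rw [Finset.sum_comm]
          _ = ∑ c, z c := by
              refine Finset.sum_congr rfl fun c _ => ?_
              rw [sum_distr_pair, sum_distr_pair]
              exact mul_self_div_self _
      _ = ∑ ω, μ ω := by simpa using (sum_mul_comp (μ := μ) Z fun _ => 1).symm
  have pointwise : ∀ ω, (μ ω - μ ω * ratio (T ω)) / Real.log 2 ≤
      μ ω * Real.logb 2 (t (T ω)) + μ ω * Real.logb 2 (z (Z ω))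
        - μ ω * Real.logb 2 (p (X ω, Z ω)) - μ ω * Real.logb 2 (q (Y ω, Z ω)) := by
    intro ω
    rcases (hμ ω).eq_or_lt with h0 | h0
    · simp [← h0]
    have hp : 0 < p (X ω, Z ω) := h0.trans_le (le_distr_apply hμ (fun ω => (X ω, Z ω)) ω)
    have hq : 0 < q (Y ω, Z ω) := h0.trans_le (le_distr_apply hμ (fun ω => (Y ω, Z ω)) ω)
    have ht : 0 < t (T ω) := h0.trans_le (le_distr_apply hμ T ω)
    have hz : 0 < z (Z ω) := h0.trans_le (le_distr_apply hμ Z ω)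
    have hlog : Real.log (ratio (T ω)) = Real.log (p (X ω, Z ω)) + Real.log (q (Y ω, Z ω))
        - (Real.log (t (T ω)) + Real.log (z (Z ω))) := by
      rw [← Real.log_mul hp.ne' hq.ne', ← Real.log_mul ht.ne' hz.ne',
        ← Real.log_div (by positivity) (by positivity)]
    have hle := Real.log_le_sub_one_of_pos (x := ratio (T ω))
      (div_pos (mul_pos hp hq) (mul_pos ht hz))
    have h2 : 0 < Real.log 2 := Real.log_pos (by norm_num)
    simp only [Real.logb, ← mul_div_assoc, ← add_div, ← sub_div]
    refine div_le_div_of_nonneg_right ?_ h2.le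
    nlinarith
  have total := Finset.sum_le_sum fun ω (_ : ω ∈ Finset.univ) => pointwise ω
  rw [← Finset.sum_div, Finset.sum_sub_distrib, Finset.sum_sub_distrib, Finset.sum_sub_distrib,
    Finset.sum_add_distrib] at total
  have hlhs : 0 ≤ (∑ ω, μ ω - ∑ ω, μ ω * ratio (T ω)) / Real.log 2 :=
    div_nonneg (sub_nonneg.2 ratio_sum) (Real.log_nonneg (by norm_num))
  rw [cmi, H_eq_sum, H_eq_sum, H_eq_sum, H_eq_sum]
  linarith

theorem cmi_comm (hμ : ∀ ω, 0 ≤ μ ω) (X : Ω → α) (Y : Ω → β) (Z : Ω → γ) :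
    cmi μ X Y Z = cmi μ Y X Z := by
  have h : H μ (fun ω => (X ω, Y ω, Z ω)) = H μ (fun ω => (Y ω, X ω, Z ω)) :=
    H_congr hμ fun ω ω' => by simp only [Prod.mk.injEq]; tauto
  rw [cmi, cmi, h]
  ring

theorem cmi_congr_right (hμ : ∀ ω, 0 ≤ μ ω) (X : Ω → α) (Y : Ω → β) {Z : Ω → γ} {Z' : Ω → δ}
    (h : ∀ ω ω', Z ω = Z ω' ↔ Z' ω = Z' ω') : cmi μ X Y Z = cmi μ X Y Z' := by
  rw [cmi, cmi, H_congr hμ h,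
    H_congr hμ (X := fun ω => (X ω, Z ω)) (Y := fun ω => (X ω, Z' ω)) (by simp [h]),
    H_congr hμ (X := fun ω => (Y ω, Z ω)) (Y := fun ω => (Y ω, Z' ω)) (by simp [h]),
    H_congr hμ (X := fun ω => (X ω, Y ω, Z ω)) (Y := fun ω => (X ω, Y ω, Z' ω)) (by simp [h])]

theorem condEnt_congr_right (hμ : ∀ ω, 0 ≤ μ ω) (X : Ω → α) {Z : Ω → γ} {Z' : Ω → δ}
    (h : ∀ ω ω', Z ω = Z ω' ↔ Z' ω = Z' ω') : condEnt μ X Z = condEnt μ X Z' := by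
  rw [condEnt, condEnt, H_congr hμ h,
    H_congr hμ (X := fun ω => (X ω, Z ω)) (Y := fun ω => (X ω, Z' ω)) (by simp [h])]

/-- Revealing a message determined by one party and the shared information preserves
conditional independence. -/
theorem cmi_eq_zero_of_message (hμ : ∀ ω, 0 ≤ μ ω) {X : Ω → α} {Y : Ω → β} {Z : Ω → γ}
    {M : Ω → δ} (hind : cmi μ X Y Z = 0) (hM : condEnt μ M (fun ω => (X ω, Z ω)) = 0) :
    cmi μ X Y (fun ω => (Z ω, M ω)) = 0 := by
  have hge := cmi_nonneg hμ X Y fun ω => (Z ω, M ω)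
  have hsub := cmi_nonneg hμ M Y Z
  have hmono : H μ (fun ω => (X ω, Y ω, Z ω)) ≤ H μ (fun ω => (X ω, Y ω, Z ω, M ω)) :=
    H_le_of_factors hμ fun ω ω' => by simp only [Prod.mk.injEq]; tauto
  have hXZM : H μ (fun ω => (M ω, X ω, Z ω)) = H μ (fun ω => (X ω, Z ω, M ω)) :=
    H_congr hμ fun ω ω' => by simp only [Prod.mk.injEq]; tauto
  have hYZM : H μ (fun ω => (M ω, Y ω, Z ω)) = H μ (fun ω => (Y ω, Z ω, M ω)) :=
    H_congr hμ fun ω ω' => by simp only [Prod.mk.injEq]; tauto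
  have hZM : H μ (fun ω => (M ω, Z ω)) = H μ (fun ω => (Z ω, M ω)) :=
    H_congr hμ fun ω ω' => by simp only [Prod.mk.injEq]; tauto
  simp only [cmi, condEnt] at *
  linarith

end Entropy

/-- interactive communication preserves conditional independence.
Let `A, B, W` be finite-valued random variables with `I(A; B | W) = 0`, and let
`C₁, …, C_r` satisfy `H(C_i | C_{1:i-1}, A, W) = 0` for odd (1-based) `i` and
`H(C_i | C_{1:i-1}, B, W) = 0` for even (1-based) `i`. Then
`I(A; B | W, C₁, …, C_r) = 0`.
(Lean index `i : Fin r` corresponds to the 1-based index `i + 1`.) -/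
theorem interactive_preserves_cond_independence
    {Ω 𝒜 ℬ 𝒲 : Type} {r : ℕ} {𝓒 : Fin r → Type}
    [Fintype Ω] [DecidableEq Ω]
    [Fintype 𝒜] [DecidableEq 𝒜] [Fintype ℬ] [DecidableEq ℬ]
    [Fintype 𝒲] [DecidableEq 𝒲]
    [∀ i, Fintype (𝓒 i)] [∀ i, DecidableEq (𝓒 i)]
    (μ : Ω → ℝ) (hμ : IsPMF μ)
    (A : Ω → 𝒜) (B : Ω → ℬ) (W : Ω → 𝒲)
    (C : (i : Fin r) → Ω → 𝓒 i)
    (hind : cmi μ A B W = 0)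
    (hodd : ∀ i : Fin r, (i : ℕ) % 2 = 0 →
      condEnt μ (C i)
        (fun ω => ((fun j : Fin (i : ℕ) => C ⟨j.1, j.2.trans i.2⟩ ω), A ω, W ω)) = 0)
    (heven : ∀ i : Fin r, (i : ℕ) % 2 = 1 →
      condEnt μ (C i)
        (fun ω => ((fun j : Fin (i : ℕ) => C ⟨j.1, j.2.trans i.2⟩ ω), B ω, W ω)) = 0) :
    cmi μ A B (fun ω => (W ω, fun i : Fin r => C i ω)) = 0 := by
  have hμ0 := hμ.1
  have prefix_indep : ∀ k (hk : k ≤ r),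
      cmi μ A B (fun ω => (W ω, fun j : Fin k => C ⟨j.1, j.2.trans_le hk⟩ ω)) = 0 := by
    intro k
    induction k with
    | zero =>
      intro hk
      rw [← hind]
      exact cmi_congr_right hμ0 A B fun ω ω' => by simp [funext_iff]
    | succ k ih =>
      intro hk
      have hZ := ih (Nat.le_of_succ_le hk)
      set Z := fun ω => (W ω, fun j : Fin k => C ⟨j.1, j.2.trans_le (Nat.le_of_succ_le hk)⟩ ω)
        with hZdef
      have hsplit : cmi μ A B
          (fun ω => (W ω, fun j : Fin (k + 1) => C ⟨j.1, j.2.trans_le hk⟩ ω)) =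
          cmi μ A B (fun ω => (Z ω, C ⟨k, hk⟩ ω)) :=
        cmi_congr_right hμ0 A B fun ω ω' => by
          simp [hZdef, funext_iff, Fin.forall_fin_succ', and_assoc]
      rw [hsplit]
      rcases Nat.mod_two_eq_zero_or_one k with hpar | hpar
      · refine cmi_eq_zero_of_message hμ0 hZ ?_
        rw [← hodd ⟨k, hk⟩ hpar]
        exact condEnt_congr_right hμ0 _ fun ω ω' => by
          simp only [hZdef, Prod.mk.injEq]; tauto
      · rw [cmi_comm hμ0] at hZ ⊢
        refine cmi_eq_zero_of_message hμ0 hZ ?_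
        rw [← heven ⟨k, hk⟩ hpar]
        exact condEnt_congr_right hμ0 _ fun ω ω' => by
          simp only [hZdef, Prod.mk.injEq]; tauto
  exact prefix_indep r le_rfl

end Coord
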